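/- Let A_1, …, A_m ∈ ℝ^{n×n} and let d ≥ 1 be an integer. Define F := {γ ∈ ℝ : γ ≥ 0 and there exists a homogeneous polynomial p ∈ ℝ[x_1,…,x_n] of degree 2d such that p(x) − (x_1² + ⋯ + x_n²)^d is SOS and γ^{2d} p(x) − p(A_i x) is SOS for every i = 1,…,m}. Then F is nonempty, and m^{−1/(2d)} · (sInf F) ≤ ρ(𝒜) ≤ sInf F. -/

import Mathlib

open MvPolynomial Filter

/-- Operator norm of a real matrix induced by the Euclidean norm on `ℝ^n`. -/
noncomputable def opNorm {n : ℕ} (A : Matrix (Fin n) (Fin n) ℝ) : ℝ :=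
  ‖LinearMap.toContinuousLinearMap (Matrix.toEuclideanLin A)‖

/-- Joint spectral radius of a family of matrices. -/
noncomputable def jsr {n m : ℕ} (A : Fin m → Matrix (Fin n) (Fin n) ℝ) : ℝ :=
  Filter.limsup
    (fun k : ℕ => ⨆ σ : Fin k → Fin m,
      opNorm ((List.ofFn fun j => A (σ j)).prod) ^ (1 / (k : ℝ)))
    Filter.atTop

/-- The polynomial `p(Ax)`, obtained by substituting the linear forms `(Ax)_i` for `x_i`. -/
noncomputable def polyComp {n : ℕ} (p : MvPolynomial (Fin n) ℝ)
    (A : Matrix (Fin n) (Fin n) ℝ) : MvPolynomial (Fin n) ℝ :=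
  MvPolynomial.aeval (fun i => ∑ j, MvPolynomial.C (A i j) * MvPolynomial.X j) p

/-- `f` is a sum of squares of homogeneous polynomials of degree `d`. -/
def IsSOSdeg {n : ℕ} (f : MvPolynomial (Fin n) ℝ) (d : ℕ) : Prop :=
  ∃ (t : ℕ) (g : Fin t → MvPolynomial (Fin n) ℝ),
    (∀ i, (g i).IsHomogeneous d) ∧ f = ∑ i, (g i) ^ 2

namespace IsSOSdeg

variable {n : ℕ}

theorem sum_sq {ι : Type*} [Fintype ι] {d : ℕ} {g : ι → MvPolynomial (Fin n) ℝ}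
    (hg : ∀ i, (g i).IsHomogeneous d) : IsSOSdeg (∑ i, g i ^ 2) d :=
  ⟨Fintype.card ι, g ∘ (Fintype.equivFin ι).symm, fun _ => hg _,
    ((Fintype.equivFin ι).symm.sum_comp fun i => g i ^ 2).symm⟩

theorem zero (d : ℕ) : IsSOSdeg (0 : MvPolynomial (Fin n) ℝ) d :=
  ⟨0, fun _ => 0, (·.elim0), by simp⟩

theorem one : IsSOSdeg (1 : MvPolynomial (Fin n) ℝ) 0 :=
  ⟨1, fun _ => 1, fun _ => isHomogeneous_one _ _, by simp⟩

theorem add {f g : MvPolynomial (Fin n) ℝ} {d : ℕ} (hf : IsSOSdeg f d) (hg : IsSOSdeg g d) :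
    IsSOSdeg (f + g) d := by
  obtain ⟨s, a, ha, rfl⟩ := hf
  obtain ⟨t, b, hb, rfl⟩ := hg
  have h := sum_sq (g := Sum.elim a b) (d := d) (by rintro (i | i) <;> simp [ha, hb])
  simpa [Fintype.sum_sum_type] using h

theorem sum {ι : Type*} {s : Finset ι} {f : ι → MvPolynomial (Fin n) ℝ} {d : ℕ}
    (hf : ∀ i ∈ s, IsSOSdeg (f i) d) : IsSOSdeg (∑ i ∈ s, f i) d :=
  Finset.sum_induction f (IsSOSdeg · d) (fun _ _ => add) (zero d) hf

theorem mul {f g : MvPolynomial (Fin n) ℝ} {d e : ℕ} (hf : IsSOSdeg f d) (hg : IsSOSdeg g e) :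
    IsSOSdeg (f * g) (d + e) := by
  obtain ⟨s, a, ha, rfl⟩ := hf
  obtain ⟨t, b, hb, rfl⟩ := hg
  have h := sum_sq (g := fun i : Fin s × Fin t => a i.1 * b i.2) fun i => (ha i.1).mul (hb i.2)
  simpa [Fintype.sum_prod_type, Finset.sum_mul_sum, mul_pow] using h

theorem pow {f : MvPolynomial (Fin n) ℝ} {d : ℕ} (hf : IsSOSdeg f d) (k : ℕ) :
    IsSOSdeg (f ^ k) (d * k) := by
  induction k with
  | zero => simpa using one
  | succ k ih => simpa [pow_succ, mul_add] using ih.mul hf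

theorem smul {f : MvPolynomial (Fin n) ℝ} {d : ℕ} (hf : IsSOSdeg f d) {c : ℝ} (hc : 0 ≤ c) :
    IsSOSdeg (c • f) d := by
  obtain ⟨s, a, ha, rfl⟩ := hf
  refine ⟨s, fun i => C (√c) * a i, fun i => (ha i).C_mul _, ?_⟩
  simp [mul_pow, ← C_pow, Real.sq_sqrt hc, Finset.smul_sum, MvPolynomial.smul_eq_C_mul]

theorem eval_nonneg {f : MvPolynomial (Fin n) ℝ} {d : ℕ} (hf : IsSOSdeg f d) (x : Fin n → ℝ) :
    0 ≤ eval x f := by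
  obtain ⟨s, a, -, rfl⟩ := hf
  simpa using Finset.sum_nonneg fun i _ => sq_nonneg (eval x (a i))

/-- If `b` and `a - b` are sums of squares of linear forms, then `a ^ k - b ^ k` is SOS. -/
theorem add_pow_sub_pow {b s : MvPolynomial (Fin n) ℝ} (hb : IsSOSdeg b 1) (hs : IsSOSdeg s 1)
    (k : ℕ) : IsSOSdeg ((b + s) ^ k - b ^ k) k := by
  induction k with
  | zero => simpa using zero 0
  | succ k ih =>
    have h1 := ih.mul (hb.add hs)
    have h2 := (hb.pow k).mul hs
    rw [one_mul] at h2
    convert h1.add h2 using 1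
    ring

end IsSOSdeg

section polyComp

variable {n : ℕ}

theorem eval_polyComp (p : MvPolynomial (Fin n) ℝ) (A : Matrix (Fin n) (Fin n) ℝ)
    (x : Fin n → ℝ) : eval x (polyComp p A) = eval (A.mulVec x) p := by
  induction p using MvPolynomial.induction_on with
  | C a => simp [polyComp]
  | add p q hp hq => simp_all [polyComp]
  | mul_X p i hp => simp_all [polyComp, Matrix.mulVec, dotProduct]

theorem polyComp_polyComp (p : MvPolynomial (Fin n) ℝ) (A B : Matrix (Fin n) (Fin n) ℝ) :
    polyComp (polyComp p A) B = polyComp p (A * B) :=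
  MvPolynomial.funext fun x => by simp [eval_polyComp, Matrix.mulVec_mulVec]

theorem polyComp_one (p : MvPolynomial (Fin n) ℝ) : polyComp p 1 = p :=
  MvPolynomial.funext fun x => by simp [eval_polyComp]

theorem MvPolynomial.IsHomogeneous.polyComp {p : MvPolynomial (Fin n) ℝ} {k : ℕ}
    (hp : p.IsHomogeneous k) (A : Matrix (Fin n) (Fin n) ℝ) :
    (polyComp p A).IsHomogeneous k := by
  have h := hp.aeval (n := 1) (fun i => ∑ j, C (A i j) * X j : Fin n → MvPolynomial (Fin n) ℝ)
    fun i => IsHomogeneous.sum _ _ _ fun j _ => (isHomogeneous_X ℝ j).C_mul _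
  rwa [one_mul] at h

theorem IsSOSdeg.polyComp {p : MvPolynomial (Fin n) ℝ} {d : ℕ} (hp : IsSOSdeg p d)
    (A : Matrix (Fin n) (Fin n) ℝ) : IsSOSdeg (polyComp p A) d := by
  obtain ⟨t, g, hg, rfl⟩ := hp
  exact ⟨t, fun i => _root_.polyComp (g i) A, fun i => (hg i).polyComp A, by simp [_root_.polyComp]⟩

end polyComp

section opNorm

variable {n : ℕ}

theorem opNorm_nonneg (A : Matrix (Fin n) (Fin n) ℝ) : 0 ≤ opNorm A :=
  norm_nonneg _

theorem norm_mulVec_le_opNorm (A : Matrix (Fin n) (Fin n) ℝ) (x : Fin n → ℝ) :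
    ‖WithLp.toLp 2 (A.mulVec x)‖ ≤ opNorm A * ‖WithLp.toLp 2 x‖ :=
  (LinearMap.toContinuousLinearMap (Matrix.toEuclideanLin A)).le_opNorm (WithLp.toLp 2 x)

theorem opNorm_le {A : Matrix (Fin n) (Fin n) ℝ} {c : ℝ} (hc : 0 ≤ c)
    (h : ∀ x, ‖WithLp.toLp 2 (A.mulVec x)‖ ≤ c * ‖WithLp.toLp 2 x‖) : opNorm A ≤ c :=
  ContinuousLinearMap.opNorm_le_bound _ hc fun x => h x.ofLp

theorem opNorm_one_le : opNorm (1 : Matrix (Fin n) (Fin n) ℝ) ≤ 1 :=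
  opNorm_le zero_le_one fun x => by simp

theorem opNorm_mul_le (A B : Matrix (Fin n) (Fin n) ℝ) :
    opNorm (A * B) ≤ opNorm A * opNorm B := by
  refine opNorm_le (mul_nonneg (opNorm_nonneg A) (opNorm_nonneg B)) fun x => ?_
  rw [← Matrix.mulVec_mulVec, mul_assoc]
  exact (norm_mulVec_le_opNorm A _).trans
    (mul_le_mul_of_nonneg_left (norm_mulVec_le_opNorm B x) (opNorm_nonneg A))

theorem opNorm_list_prod_le {c : ℝ} (hc : 0 ≤ c) (L : List (Matrix (Fin n) (Fin n) ℝ))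
    (hL : ∀ A ∈ L, opNorm A ≤ c) : opNorm L.prod ≤ c ^ L.length := by
  induction L with
  | nil => simpa using opNorm_one_le
  | cons A L ih =>
    rw [List.prod_cons, List.length_cons, pow_succ']
    exact (opNorm_mul_le _ _).trans (mul_le_mul (hL A (by simp))
      (ih fun B hB => hL B (by simp [hB])) (opNorm_nonneg _) hc)

theorem sq_norm_toLp (x : Fin n → ℝ) : ‖WithLp.toLp 2 x‖ ^ 2 = x ⬝ᵥ x := by
  rw [EuclideanSpace.norm_sq_eq]
  simp [dotProduct, sq]

end opNorm

section normSqPoly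

/-- The quadratic form `x_1² + ⋯ + x_n²`. -/
noncomputable def normSqPoly (n : ℕ) : MvPolynomial (Fin n) ℝ :=
  ∑ j, X j ^ 2

variable {n : ℕ}

theorem eval_normSqPoly (x : Fin n → ℝ) : eval x (normSqPoly n) = ‖WithLp.toLp 2 x‖ ^ 2 := by
  simp [normSqPoly, EuclideanSpace.norm_sq_eq]

theorem isSOSdeg_normSqPoly : IsSOSdeg (normSqPoly n) 1 :=
  IsSOSdeg.sum_sq fun j => isHomogeneous_X ℝ j

theorem normSqPoly_isHomogeneous : (normSqPoly n).IsHomogeneous 2 :=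
  IsHomogeneous.sum _ _ _ fun j _ => by simpa using (isHomogeneous_X ℝ j).pow 2

open scoped MatrixOrder in
theorem exists_polyComp_normSqPoly_add (B : Matrix (Fin n) (Fin n) ℝ) :
    ∃ D : Matrix (Fin n) (Fin n) ℝ,
      polyComp (normSqPoly n) B + polyComp (normSqPoly n) D = opNorm B ^ 2 • normSqPoly n := by
  have key : ∀ (M : Matrix (Fin n) (Fin n) ℝ) x, x ⬝ᵥ ((M.transpose * M).mulVec x) =
      ‖WithLp.toLp 2 (M.mulVec x)‖ ^ 2 := fun M x => by
    rw [sq_norm_toLp, ← Matrix.mulVec_mulVec, Matrix.dotProduct_mulVec, Matrix.vecMul_transpose]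
  have hpos : (opNorm B ^ 2 • (1 : Matrix (Fin n) (Fin n) ℝ)
      - B.transpose * B).PosSemidef := by
    refine Matrix.PosSemidef.of_dotProduct_mulVec_nonneg ?_ fun x => ?_
    · simp [Matrix.IsHermitian, Matrix.conjTranspose_eq_transpose_of_trivial,
        Matrix.transpose_mul]
    · rw [star_trivial, Matrix.sub_mulVec, dotProduct_sub, key, Matrix.smul_mulVec,
        Matrix.one_mulVec, dotProduct_smul, smul_eq_mul, ← sq_norm_toLp, ← mul_pow, sub_nonneg]
      exact pow_le_pow_left₀ (norm_nonneg _) (norm_mulVec_le_opNorm B x) 2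
  obtain ⟨D, hD⟩ := CStarAlgebra.nonneg_iff_eq_star_mul_self.mp hpos.nonneg
  rw [Matrix.star_eq_conjTranspose, Matrix.conjTranspose_eq_transpose_of_trivial] at hD
  refine ⟨D, MvPolynomial.funext fun x => ?_⟩
  have h := key D x
  rw [← hD, Matrix.sub_mulVec, dotProduct_sub, key, Matrix.smul_mulVec, Matrix.one_mulVec,
    dotProduct_smul, smul_eq_mul, ← sq_norm_toLp] at h
  simp only [map_add, eval_polyComp, eval_normSqPoly, smul_eval]
  linarith

theorem isSOSdeg_opNorm_smul_sub (B : Matrix (Fin n) (Fin n) ℝ) (d : ℕ) :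
    IsSOSdeg (opNorm B ^ (2 * d) • normSqPoly n ^ d - polyComp (normSqPoly n ^ d) B) d := by
  obtain ⟨D, hD⟩ := exists_polyComp_normSqPoly_add B
  have h := (isSOSdeg_normSqPoly.polyComp B).add_pow_sub_pow (isSOSdeg_normSqPoly.polyComp D) d
  rw [hD, smul_pow, ← pow_mul] at h
  simpa [polyComp] using h

end normSqPoly

section wordSum

variable {n m : ℕ}

/-- The sum of `p(A_{σ_1} ⋯ A_{σ_k} x)` over all words `σ` of length `k`. -/
noncomputable def wordSum (A : Fin m → Matrix (Fin n) (Fin n) ℝ) (p : MvPolynomial (Fin n) ℝ)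
    (k : ℕ) : MvPolynomial (Fin n) ℝ :=
  ∑ σ : Fin k → Fin m, polyComp p (List.ofFn fun j => A (σ j)).prod

variable (A : Fin m → Matrix (Fin n) (Fin n) ℝ) (p : MvPolynomial (Fin n) ℝ)

theorem wordSum_zero : wordSum A p 0 = p := by
  simp [wordSum, polyComp_one]

theorem sum_polyComp_wordSum (k : ℕ) :
    ∑ i, polyComp (wordSum A p k) (A i) = wordSum A p (k + 1) := by
  have h : ∀ i, polyComp (wordSum A p k) (A i) = ∑ σ : Fin k → Fin m,
      polyComp p ((List.ofFn fun j => A (σ j)).prod * A i) := fun i => by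
    simp only [← polyComp_polyComp]
    simp [wordSum, polyComp]
  rw [Finset.sum_congr rfl fun i _ => h i, ← Fintype.sum_prod_type', wordSum]
  refine Fintype.sum_equiv (Fin.snocEquiv fun _ => Fin m) _ _ fun σ => ?_
  rw [List.ofFn_succ']
  simp [Fin.snocEquiv]

variable {A p}

theorem isSOSdeg_wordSum {d : ℕ} (hp : IsSOSdeg p d) (k : ℕ) : IsSOSdeg (wordSum A p k) d :=
  IsSOSdeg.sum fun _ _ => hp.polyComp _

theorem wordSum_isHomogeneous {d : ℕ} (hp : p.IsHomogeneous d) (k : ℕ) :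
    (wordSum A p k).IsHomogeneous d :=
  IsHomogeneous.sum _ _ _ fun _ _ => hp.polyComp _

end wordSum

section feasible

variable {n m : ℕ} {A : Fin m → Matrix (Fin n) (Fin n) ℝ} {d : ℕ} {γ : ℝ}

/-- `γ` belongs to the feasible set of the SOS relaxation of order `d`. -/
def IsSOSFeasible (A : Fin m → Matrix (Fin n) (Fin n) ℝ) (d : ℕ) (γ : ℝ) : Prop :=
  0 ≤ γ ∧ ∃ p : MvPolynomial (Fin n) ℝ, p.IsHomogeneous (2 * d) ∧
    IsSOSdeg (p - normSqPoly n ^ d) d ∧ ∀ i, IsSOSdeg (γ ^ (2 * d) • p - polyComp p (A i)) d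

theorem isSOSFeasible_of_sum_le (hγ : 0 < γ) {N : ℕ} (hN : 1 ≤ N)
    (h : ∑ σ : Fin N → Fin m, opNorm (List.ofFn fun j => A (σ j)).prod ^ (2 * d) ≤
      (γ ^ (2 * d)) ^ N) : IsSOSFeasible A d γ := by
  set c := γ ^ (2 * d) with hc
  have hc0 : 0 < c := by positivity
  set q := normSqPoly n ^ d
  have hqs : IsSOSdeg q d := by simpa using isSOSdeg_normSqPoly.pow d
  have hqh : q.IsHomogeneous (2 * d) := normSqPoly_isHomogeneous.pow d
  have hW : ∀ k, IsSOSdeg ((c⁻¹ ^ k) • wordSum A q k) d := fun k =>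
    (isSOSdeg_wordSum hqs k).smul (by positivity)
  set p := ∑ k ∈ Finset.range N, (c⁻¹ ^ k) • wordSum A q k with hp
  have hps : IsSOSdeg p d := IsSOSdeg.sum fun k _ => hW k
  refine ⟨hγ.le, p, ?_, ?_, fun i => ?_⟩
  · refine IsHomogeneous.sum _ _ _ fun k _ => ?_
    rw [MvPolynomial.smul_eq_C_mul]
    exact (wordSum_isHomogeneous hqh k).C_mul _
  · obtain ⟨N, rfl⟩ := Nat.exists_eq_add_of_le' hN
    rw [hp, Finset.sum_range_succ', pow_zero, one_smul, wordSum_zero, add_sub_cancel_right]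
    exact IsSOSdeg.sum fun k _ => hW (k + 1)
  · have hT : ∑ i, polyComp p (A i) =
        ∑ k ∈ Finset.range N, (c⁻¹ ^ k) • wordSum A q (k + 1) := by
      simp only [← sum_polyComp_wordSum, Finset.smul_sum]
      rw [Finset.sum_comm]
      simp [hp, polyComp]
    have htel : c • p - ∑ i, polyComp p (A i) = c • (q - (c⁻¹ ^ N) • wordSum A q N) := by
      have h1 := Finset.sum_range_sub' (fun k => (c⁻¹ ^ k) • wordSum A q k) N
      simp only [pow_zero, one_smul, wordSum_zero] at h1
      rw [hT, hp, ← h1, Finset.smul_sum, Finset.smul_sum, ← Finset.sum_sub_distrib]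
      refine Finset.sum_congr rfl fun k _ => ?_
      rw [smul_sub, smul_smul c (c⁻¹ ^ (k + 1)), pow_succ' c⁻¹ k, mul_inv_cancel_left₀ hc0.ne']
    have hlast : IsSOSdeg (c ^ N • q - wordSum A q N) d := by
      have h2 : IsSOSdeg (∑ σ : Fin N → Fin m,
          (opNorm (List.ofFn fun j => A (σ j)).prod ^ (2 * d) • q -
            polyComp q (List.ofFn fun j => A (σ j)).prod)) d :=
        IsSOSdeg.sum fun σ _ => isSOSdeg_opNorm_smul_sub _ d
      rw [Finset.sum_sub_distrib, ← Finset.sum_smul] at h2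
      convert h2.add (hqs.smul (sub_nonneg.mpr h)) using 1
      rw [sub_smul, wordSum]
      abel
    have hfull : IsSOSdeg (c • p - ∑ i, polyComp p (A i)) d := by
      rw [htel]
      convert (hlast.smul (c := c⁻¹ ^ N) (by positivity)).smul hc0.le using 2
      rw [smul_sub, smul_smul, ← mul_pow, inv_mul_cancel₀ hc0.ne', one_pow, one_smul]
    have hrest : IsSOSdeg (∑ j ∈ Finset.univ.erase i, polyComp p (A j)) d :=
      IsSOSdeg.sum fun j _ => hps.polyComp _
    convert hfull.add hrest using 1
    rw [← Finset.add_sum_erase _ _ (Finset.mem_univ i)]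
    abel

end feasible

theorem MvPolynomial.IsHomogeneous.exists_abs_eval_le {n k : ℕ} {p : MvPolynomial (Fin n) ℝ}
    (hp : p.IsHomogeneous k) :
    ∃ c : ℝ, 0 < c ∧ ∀ x, |eval x p| ≤ c * ‖WithLp.toLp 2 x‖ ^ k := by
  refine ⟨∑ s ∈ p.support, |coeff s p| + 1, by positivity, fun x => ?_⟩
  have h1 : |eval x p| ≤ ∑ s ∈ p.support, |coeff s p| * ‖WithLp.toLp 2 x‖ ^ k := by
    rw [eval_eq']
    refine (Finset.abs_sum_le_sum_abs _ _).trans (Finset.sum_le_sum fun s hs => ?_)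
    rw [abs_mul]
    refine mul_le_mul_of_nonneg_left ?_ (abs_nonneg _)
    have hdeg : ∑ i, s i = k := by
      have := hp (mem_support_iff.mp hs)
      rw [Finsupp.weight_apply, Finsupp.sum_fintype _ _ (by simp)] at this
      simpa using this
    rw [Finset.abs_prod, ← hdeg, ← Finset.prod_pow_eq_pow_sum]
    refine Finset.prod_le_prod (fun i _ => abs_nonneg _) fun i _ => ?_
    rw [abs_pow]
    exact pow_le_pow_left₀ (abs_nonneg _) (PiLp.norm_apply_le (WithLp.toLp 2 x) i) _
  rw [add_mul, Finset.sum_mul]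
  exact h1.trans (le_add_of_nonneg_right (by positivity))

section feasible

variable {n m : ℕ} {A : Fin m → Matrix (Fin n) (Fin n) ℝ} {d : ℕ} {γ : ℝ}

theorem IsSOSFeasible.exists_opNorm_pow_le (h : IsSOSFeasible A d γ) (hd : d ≠ 0) :
    ∃ c : ℝ, 0 < c ∧ ∀ L : List (Fin m), opNorm (L.map A).prod ≤ c * γ ^ L.length := by
  obtain ⟨hγ, p, hph, hp, hpA⟩ := h
  obtain ⟨c, hc, hpc⟩ := hph.exists_abs_eval_le
  have hstep : ∀ (L : List (Fin m)) x,
      eval ((L.map A).prod.mulVec x) p ≤ (γ ^ L.length) ^ (2 * d) * eval x p := by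
    intro L
    induction L with
    | nil => simp
    | cons i L ih =>
      intro x
      have h1 := (hpA i).eval_nonneg ((L.map A).prod.mulVec x)
      rw [map_sub, smul_eval, eval_polyComp, sub_nonneg, Matrix.mulVec_mulVec] at h1
      rw [List.map_cons, List.prod_cons, List.length_cons, pow_succ', mul_pow, mul_assoc]
      exact h1.trans (mul_le_mul_of_nonneg_left (ih x) (by positivity))
  have h2d : 2 * d ≠ 0 := by omega
  refine ⟨c ^ (((2 * d : ℕ) : ℝ)⁻¹), by positivity, fun L => opNorm_le (by positivity) fun x => ?_⟩
  refine le_of_pow_le_pow_left₀ h2d (by positivity) ?_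
  rw [mul_pow, mul_pow, Real.rpow_inv_natCast_pow hc.le h2d]
  have hlow := hp.eval_nonneg ((L.map A).prod.mulVec x)
  rw [map_sub, map_pow, eval_normSqPoly, ← pow_mul, sub_nonneg] at hlow
  calc _ ≤ _ := hlow
    _ ≤ _ := hstep L x
    _ ≤ (γ ^ L.length) ^ (2 * d) * (c * ‖WithLp.toLp 2 x‖ ^ (2 * d)) :=
      mul_le_mul_of_nonneg_left ((le_abs_self _).trans (hpc x)) (by positivity)
    _ = _ := by ring

end feasible

section jsr

variable {n m : ℕ} (A : Fin m → Matrix (Fin n) (Fin n) ℝ)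

/-- The maximal `k`-th root of the norm of a product of `k` of the matrices. -/
noncomputable def maxGrowth (k : ℕ) : ℝ :=
  ⨆ σ : Fin k → Fin m, opNorm ((List.ofFn fun j => A (σ j)).prod) ^ (1 / (k : ℝ))

theorem maxGrowth_nonneg (k : ℕ) : 0 ≤ maxGrowth A k :=
  Real.iSup_nonneg fun _ => Real.rpow_nonneg (opNorm_nonneg _) _

theorem isCoboundedUnder_maxGrowth : IsCoboundedUnder (· ≤ ·) atTop (maxGrowth A) :=
  isCoboundedUnder_le_of_le atTop (x := 0) (maxGrowth_nonneg A)

variable {A}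

theorem opNorm_le_maxGrowth_pow {k : ℕ} (hk : k ≠ 0) (σ : Fin k → Fin m) :
    opNorm (List.ofFn fun j => A (σ j)).prod ≤ maxGrowth A k ^ k := by
  have h := le_ciSup (f := fun σ : Fin k → Fin m =>
    opNorm ((List.ofFn fun j => A (σ j)).prod) ^ (1 / (k : ℝ))) (Set.finite_range _).bddAbove σ
  change _ ≤ maxGrowth A k at h
  have h2 := pow_le_pow_left₀ (Real.rpow_nonneg (opNorm_nonneg _) _) h k
  rwa [one_div, Real.rpow_inv_natCast_pow (opNorm_nonneg _) hk] at h2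

theorem maxGrowth_le {k : ℕ} (hk : k ≠ 0) {c γ : ℝ} (hc : 0 ≤ c) (hγ : 0 ≤ γ)
    (h : ∀ L : List (Fin m), opNorm (L.map A).prod ≤ c * γ ^ L.length) :
    maxGrowth A k ≤ c ^ (1 / (k : ℝ)) * γ := by
  refine Real.iSup_le (fun σ => ?_) (by positivity)
  have h1 := h (List.ofFn σ)
  rw [List.map_ofFn, List.length_ofFn] at h1
  refine (Real.rpow_le_rpow (opNorm_nonneg _) h1 (by positivity)).trans_eq ?_
  rw [Real.mul_rpow hc (by positivity), one_div, Real.pow_rpow_inv_natCast hγ hk]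

theorem isBoundedUnder_maxGrowth : IsBoundedUnder (· ≤ ·) atTop (maxGrowth A) := by
  refine isBoundedUnder_of_eventually_le (a := ∑ i, opNorm (A i)) ?_
  have h0 : 0 ≤ ∑ i, opNorm (A i) := Finset.sum_nonneg fun i _ => opNorm_nonneg _
  filter_upwards [eventually_ne_atTop 0] with k hk
  have h := maxGrowth_le (A := A) hk zero_le_one h0 fun L => by
    have := opNorm_list_prod_le h0 (L.map A) fun B hB => by
      obtain ⟨i, -, rfl⟩ := List.mem_map.mp hB
      exact Finset.single_le_sum (fun i _ => opNorm_nonneg (A i)) (Finset.mem_univ i)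
    simpa using this
  simpa using h

theorem jsr_nonneg : 0 ≤ jsr A :=
  le_limsup_of_frequently_le (Frequently.of_forall (maxGrowth_nonneg A)) isBoundedUnder_maxGrowth

theorem IsSOSFeasible.jsr_le {d : ℕ} {γ : ℝ} (h : IsSOSFeasible A d γ) (hd : d ≠ 0) :
    jsr A ≤ γ := by
  obtain ⟨c, hc, hL⟩ := h.exists_opNorm_pow_le hd
  have hlim : Tendsto (fun k : ℕ => c ^ (1 / (k : ℝ)) * γ) atTop (nhds γ) := by
    have h1 := (Real.continuousAt_const_rpow (a := c) (b := 0) hc.ne').tendsto.comp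
      (tendsto_one_div_atTop_nhds_zero_nat (𝕜 := ℝ))
    simpa [Function.comp_def] using h1.mul_const γ
  rw [← hlim.limsup_eq]
  refine limsup_le_limsup ?_ (isCoboundedUnder_maxGrowth A) hlim.isBoundedUnder_le
  filter_upwards [eventually_ne_atTop 0] with k hk
  exact maxGrowth_le hk hc.le h.1 hL

theorem isSOSFeasible_of_jsr_lt {d : ℕ} (hd : d ≠ 0) (hm : m ≠ 0) {r : ℝ} (hr : jsr A < r) :
    IsSOSFeasible A d ((m : ℝ) ^ (1 / (2 * d : ℝ)) * r) := by
  have hr0 : 0 < r := jsr_nonneg.trans_lt hr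
  have hm0 : (0 : ℝ) < m := by positivity
  obtain ⟨N, hN, hN1⟩ := ((eventually_lt_of_limsup_lt hr isBoundedUnder_maxGrowth).and
    (eventually_ge_atTop 1)).exists
  refine isSOSFeasible_of_sum_le (by positivity) hN1 ?_
  have hroot : ((m : ℝ) ^ (1 / (2 * d : ℝ))) ^ (2 * d) = m := by
    have := Real.rpow_inv_natCast_pow hm0.le (n := 2 * d) (by omega)
    simpa using this
  rw [mul_pow, hroot, mul_pow, ← pow_mul r]
  calc _ ≤ ∑ σ : Fin N → Fin m, (r ^ N) ^ (2 * d) := by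
        refine Finset.sum_le_sum fun σ _ => pow_le_pow_left₀ (opNorm_nonneg _) ?_ _
        exact (opNorm_le_maxGrowth_pow (by omega) σ).trans
          (pow_le_pow_left₀ (maxGrowth_nonneg A N) hN.le N)
    _ = _ := by simp [← pow_mul, mul_comm]

end jsr

/-- The feasible set `F` of the SOS relaxation of order `d` is nonempty and its infimum
`ρ_{SOS,2d}(𝒜) = sInf F` satisfies `m^{-1/(2d)} · sInf F ≤ ρ(𝒜) ≤ sInf F`. -/
theorem stmt1 {n m : ℕ} (A : Fin m → Matrix (Fin n) (Fin n) ℝ) (d : ℕ) (hd : 1 ≤ d)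
    (F : Set ℝ)
    (hF : F = {γ : ℝ | 0 ≤ γ ∧ ∃ p : MvPolynomial (Fin n) ℝ,
      p.IsHomogeneous (2 * d) ∧
      IsSOSdeg (p - (∑ j, MvPolynomial.X j ^ 2) ^ d) d ∧
      ∀ i, IsSOSdeg (γ ^ (2 * d) • p - polyComp p (A i)) d}) :
    F.Nonempty ∧
    (m : ℝ) ^ (-(1 / (2 * d : ℝ))) * sInf F ≤ jsr A ∧
    jsr A ≤ sInf F := by
  have hd0 : d ≠ 0 := by omega
  change F = {γ | IsSOSFeasible A d γ} at hF
  subst hF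
  have hbdd : BddBelow {γ | IsSOSFeasible A d γ} := ⟨0, fun γ hγ => hγ.1⟩
  have hne : {γ | IsSOSFeasible A d γ}.Nonempty := by
    rcases eq_or_ne m 0 with rfl | hm
    · exact ⟨1, isSOSFeasible_of_sum_le one_pos le_rfl (by simp)⟩
    · exact ⟨_, isSOSFeasible_of_jsr_lt hd0 hm (lt_add_one (jsr A))⟩
  refine ⟨hne, ?_, le_csInf hne fun γ hγ => hγ.jsr_le hd0⟩
  rcases eq_or_ne m 0 with rfl | hm
  · rw [Nat.cast_zero, Real.zero_rpow (by simpa using hd0), zero_mul]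
    exact jsr_nonneg
  · refine le_of_forall_gt_imp_ge_of_dense fun r hr => ?_
    have hm0 : (0 : ℝ) < m := by positivity
    rw [Real.rpow_neg hm0.le, inv_mul_le_iff₀ (by positivity)]
    exact csInf_le hbdd (isSOSFeasible_of_jsr_lt hd0 hm hr)
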